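/- arXiv:1406.2661 — 2 statements merged into one kernel-verified Lean document; each statement's English description precedes it below -/
import Mathlib

section
/- (Uniqueness in Proposition 1.) Let (X, μ) be a measure space and let p, q : X → ℝ≥0 be measurable probability density functions with respect to μ. If D : X → [0,1] is measurable and V(D) = V(D*) > −∞, where D*(x) = p(x)/(p(x)+q(x)) on {p+q > 0} and V(D) = ∫ p·log D dμ + ∫ q·log(1−D) dμ, then D(x) = D*(x) for μ-almost every x in the set {x : p(x)+q(x) > 0}. -/
open MeasureTheory
open scoped NNReal ENNReal

/-- Truncation of an extended real to `ℝ≥0∞` (negatives and `⊥` map to `0`). -/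
noncomputable def erealToENNReal (x : EReal) : ℝ≥0∞ :=
  if x = ⊤ then ⊤ else ENNReal.ofReal x.toReal

/-- Integral of an extended-real-valued function, defined via the positive and
negative parts, with values in the extended reals. -/
noncomputable def eIntegral {X : Type*} [MeasurableSpace X] (μ : Measure X)
    (f : X → EReal) : EReal :=
  ((∫⁻ x, erealToENNReal (f x) ∂μ : ℝ≥0∞) : EReal)
    - ((∫⁻ x, erealToENNReal (-(f x)) ∂μ : ℝ≥0∞) : EReal)

/-- The GAN value function `V(D) = ∫ p·log D dμ + ∫ q·log (1 - D) dμ`, with the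
conventions `log 0 = -∞` and `0·(-∞) = 0` (via `ENNReal.log` and `EReal` arithmetic). -/
noncomputable def V {X : Type*} [MeasurableSpace X] (μ : Measure X)
    (p q : X → ℝ≥0) (D : X → ℝ) : EReal :=
  eIntegral μ (fun x => ((p x : ℝ≥0∞) : EReal) * ENNReal.log (ENNReal.ofReal (D x)))
    + eIntegral μ (fun x => ((q x : ℝ≥0∞) : EReal) * ENNReal.log (ENNReal.ofReal (1 - D x)))

/-- The optimal discriminator `D*(x) = p(x)/(p(x)+q(x))` on `{p+q > 0}`, set to `1/2`
elsewhere. -/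
noncomputable def Dstar {X : Type*} (p q : X → ℝ≥0) (x : X) : ℝ :=
  if p x + q x = 0 then 1 / 2 else (p x : ℝ) / ((p x : ℝ) + (q x : ℝ))

/-- The GAN criterion `C(p,q) = ∫ p·log (p/(p+q)) dμ + ∫ q·log (q/(p+q)) dμ`. -/
noncomputable def Cval {X : Type*} [MeasurableSpace X] (μ : Measure X)
    (p q : X → ℝ≥0) : EReal :=
  eIntegral μ (fun x =>
      ((p x : ℝ≥0∞) : EReal) * ENNReal.log ((p x : ℝ≥0∞) / ((p x : ℝ≥0∞) + (q x : ℝ≥0∞))))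
    + eIntegral μ (fun x =>
      ((q x : ℝ≥0∞) : EReal) * ENNReal.log ((q x : ℝ≥0∞) / ((p x : ℝ≥0∞) + (q x : ℝ≥0∞))))

/-- The Kullback--Leibler divergence `KL(f ‖ g) = ∫ f·log (f/g) dμ` between densities,
with the conventions `0·log (0/g) = 0` and `f·log (f/0) = +∞` for `f > 0`. -/
noncomputable def klDiv {X : Type*} [MeasurableSpace X] (μ : Measure X)
    (f g : X → ℝ≥0) : EReal :=
  eIntegral μ (fun x => ((f x : ℝ≥0∞) : EReal) * ENNReal.log ((f x : ℝ≥0∞) / (g x : ℝ≥0∞)))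


/-- The real-or-infinite loss `-a * log t`, with `0 * log 0 = 0` and `-a * log 0 = ∞` for `a > 0`. -/
noncomputable def logLoss (a : ℝ≥0) (t : ℝ) : ℝ≥0∞ :=
  if a = 0 then 0 else if t ≤ 0 then ⊤ else ENNReal.ofReal (-(a * Real.log t))

theorem logLoss_of_pos_or {a : ℝ≥0} {t : ℝ} (h : a = 0 ∨ 0 < t) :
    logLoss a t = ENNReal.ofReal (-(a * Real.log t)) := by
  unfold logLoss
  rcases eq_or_ne a 0 with rfl | ha
  · simp
  · rw [if_neg ha, if_neg (not_le.2 (h.resolve_left ha))]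

theorem measurable_logLoss {X : Type*} [MeasurableSpace X] {p : X → ℝ≥0} {D : X → ℝ}
    (hp : Measurable p) (hD : Measurable D) : Measurable fun x => logLoss (p x) (D x) := by
  unfold logLoss
  refine Measurable.ite (hp (measurableSet_singleton 0)) measurable_const
    (Measurable.ite (measurableSet_le hD measurable_const) measurable_const ?_)
  fun_prop

theorem erealToENNReal_coe (r : ℝ) : erealToENNReal (r : EReal) = ENNReal.ofReal r := by
  simp [erealToENNReal]

theorem erealToENNReal_neg_mul_log (a : ℝ≥0) (t : ℝ) :
    erealToENNReal (-(((a : ℝ≥0∞) : EReal) * ENNReal.log (ENNReal.ofReal t))) = logLoss a t := by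
  rcases eq_or_ne a 0 with rfl | ha
  · simp [erealToENNReal, logLoss]
  have ha' : (0 : EReal) < ((a : ℝ) : EReal) := by exact_mod_cast pos_iff_ne_zero.2 ha
  have hcoe : ((a : ℝ≥0∞) : EReal) = ((a : ℝ) : EReal) := rfl
  rcases le_or_gt t 0 with ht | ht
  · simp [erealToENNReal, logLoss, ha, ht, ENNReal.ofReal_of_nonpos ht, hcoe,
      EReal.mul_bot_of_pos ha']
  · rw [ENNReal.log_ofReal_of_pos ht, hcoe, ← EReal.coe_mul, ← EReal.coe_neg, erealToENNReal_coe,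
      logLoss_of_pos_or (Or.inr ht)]

theorem erealToENNReal_of_nonpos {x : EReal} (hx : x ≤ 0) : erealToENNReal x = 0 := by
  have hx' : x ≠ ⊤ := (hx.trans_lt EReal.zero_lt_top).ne
  rw [erealToENNReal, if_neg hx', ENNReal.ofReal_eq_zero]
  exact EReal.toReal_nonpos hx

theorem eIntegral_mul_log {X : Type*} [MeasurableSpace X] (μ : Measure X) (p : X → ℝ≥0)
    {D : X → ℝ} (hD : ∀ x, D x ≤ 1) :
    eIntegral μ (fun x => ((p x : ℝ≥0∞) : EReal) * ENNReal.log (ENNReal.ofReal (D x)))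
      = -((∫⁻ x, logLoss (p x) (D x) ∂μ : ℝ≥0∞) : EReal) := by
  have hpos (x : X) : erealToENNReal
      (((p x : ℝ≥0∞) : EReal) * ENNReal.log (ENNReal.ofReal (D x))) = 0 := by
    refine erealToENNReal_of_nonpos (EReal.mul_nonpos_iff.2 (Or.inl ⟨EReal.coe_ennreal_nonneg _, ?_⟩))
    rw [← ENNReal.log_one]
    exact ENNReal.log_monotone (by simpa using hD x)
  simp only [eIntegral, hpos, erealToENNReal_neg_mul_log]
  simp

theorem V_eq_neg_lintegral_logLoss {X : Type*} [MeasurableSpace X] (μ : Measure X)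
    {p : X → ℝ≥0} (q : X → ℝ≥0) {D : X → ℝ} (hp : Measurable p) (hD : Measurable D)
    (hD01 : ∀ x, D x ∈ Set.Icc (0 : ℝ) 1) :
    V μ p q D = -((∫⁻ x, logLoss (p x) (D x) + logLoss (q x) (1 - D x) ∂μ : ℝ≥0∞) : EReal) := by
  rw [V, eIntegral_mul_log μ p fun x => (hD01 x).2,
    eIntegral_mul_log μ q fun x => by linarith [(hD01 x).1],
    lintegral_add_left (measurable_logLoss hp hD), EReal.coe_ennreal_add,
    EReal.neg_add (Or.inl (EReal.coe_ennreal_ne_bot _)) (Or.inr (EReal.coe_ennreal_ne_bot _)),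
    sub_eq_add_neg]

theorem mul_log_sub_log_div_lt {a m t : ℝ} (ha : 0 ≤ a) (hm : 0 < m) (ht : 0 < t)
    (hne : t ≠ a / m) : a * Real.log t - a * Real.log (a / m) < m * t - a := by
  rcases ha.eq_or_lt with rfl | ha
  · simpa using mul_pos hm ht
  have hs : 0 < a / m := div_pos ha hm
  have h := Real.log_lt_sub_one_of_pos (div_pos ht hs) (by rwa [Ne, div_eq_one_iff_eq hs.ne'])
  rw [Real.log_div ht.ne' hs.ne'] at h
  calc a * Real.log t - a * Real.log (a / m) = a * (Real.log t - Real.log (a / m)) := by ring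
    _ < a * (t / (a / m) - 1) := mul_lt_mul_of_pos_left h ha
    _ = m * t - a := by field_simp

/-- Strict Gibbs inequality for two-point distributions, with infinite losses allowed. -/
theorem logLoss_add_logLoss_lt {a b : ℝ≥0} {t : ℝ} (hab : a + b ≠ 0)
    (ht : t ∈ Set.Icc (0 : ℝ) 1) (hne : t ≠ (a : ℝ) / (a + b)) :
    logLoss a ((a : ℝ) / (a + b)) + logLoss b (1 - (a : ℝ) / (a + b))
      < logLoss a t + logLoss b (1 - t) := by
  have hm : (0 : ℝ) < a + b := by exact_mod_cast pos_iff_ne_zero.2 hab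
  have hs : 1 - (a : ℝ) / (a + b) = b / (a + b) := by field_simp; ring
  have hpos (c : ℝ≥0) : c = 0 ∨ 0 < (c : ℝ) / (a + b) :=
    (eq_or_ne c 0).imp_right fun hc => div_pos (by exact_mod_cast pos_iff_ne_zero.2 hc) hm
  have hle (c : ℝ≥0) {u : ℝ} (h0 : 0 ≤ u) (h1 : u ≤ 1) : 0 ≤ -((c : ℝ) * Real.log u) :=
    neg_nonneg.2 (mul_nonpos_of_nonneg_of_nonpos c.2 (Real.log_nonpos h0 h1))
  have ha1 : (a : ℝ) / (a + b) ≤ 1 := div_le_one_of_le₀ (by simp) hm.le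
  have hb1 : (b : ℝ) / (a + b) ≤ 1 := div_le_one_of_le₀ (by simp) hm.le
  rw [hs, logLoss_of_pos_or (hpos a), logLoss_of_pos_or (hpos b),
    ← ENNReal.ofReal_add (hle a (by positivity) ha1) (hle b (by positivity) hb1)]
  rcases ht.1.eq_or_lt with rfl | ht0
  · have ha : a ≠ 0 := by rintro rfl; simp at hne
    simp [logLoss, ha]
  rcases ht.2.eq_or_lt with rfl | ht1
  · have hb : b ≠ 0 := by
      rintro rfl
      exact hne (by rw [NNReal.coe_zero, add_zero] at hm ⊢; exact (div_self hm.ne').symm)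
    simp [logLoss, hb]
  have ht1' : 0 < 1 - t := sub_pos.2 ht1
  have h1 := mul_log_sub_log_div_lt a.2 hm ht0 hne
  have h2 := mul_log_sub_log_div_lt b.2 hm ht1' (by
    intro h
    apply hne
    linarith [hs.trans h.symm])
  rw [logLoss_of_pos_or (Or.inr ht0), logLoss_of_pos_or (Or.inr ht1'),
    ← ENNReal.ofReal_add (hle a ht0.le ht1.le) (hle b ht1'.le (by linarith))]
  have hA := hle a (by positivity) ha1
  have hB := hle b (by positivity) hb1
  refine (ENNReal.ofReal_lt_ofReal_iff_of_nonneg (add_nonneg hA hB)).2 ?_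
  simp only [NNReal.val_eq_coe] at h1 h2
  linarith

theorem measurable_Dstar {X : Type*} [MeasurableSpace X] {p q : X → ℝ≥0}
    (hp : Measurable p) (hq : Measurable q) : Measurable (Dstar p q) := by
  refine Measurable.ite ((hp.add hq) (measurableSet_singleton 0)) measurable_const ?_
  fun_prop

theorem Dstar_mem_Icc {X : Type*} (p q : X → ℝ≥0) (x : X) :
    Dstar p q x ∈ Set.Icc (0 : ℝ) 1 := by
  unfold Dstar
  split_ifs
  · norm_num
  · exact ⟨by positivity, div_le_one_of_le₀ (by simp) (by positivity)⟩

theorem logLoss_Dstar_lt {X : Type*} {p q : X → ℝ≥0} {x : X} {t : ℝ} (hx : p x + q x ≠ 0)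
    (ht : t ∈ Set.Icc (0 : ℝ) 1) (hne : t ≠ Dstar p q x) :
    logLoss (p x) (Dstar p q x) + logLoss (q x) (1 - Dstar p q x)
      < logLoss (p x) t + logLoss (q x) (1 - t) := by
  rw [Dstar, if_neg hx] at hne ⊢
  exact logLoss_add_logLoss_lt hx ht hne

theorem logLoss_Dstar_le {X : Type*} (p q : X → ℝ≥0) (x : X) {t : ℝ}
    (ht : t ∈ Set.Icc (0 : ℝ) 1) :
    logLoss (p x) (Dstar p q x) + logLoss (q x) (1 - Dstar p q x)
      ≤ logLoss (p x) t + logLoss (q x) (1 - t) := by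
  by_cases hx : p x + q x = 0
  · obtain ⟨hpx, hqx⟩ := add_eq_zero.1 hx
    simp [logLoss, hpx, hqx]
  rcases eq_or_ne t (Dstar p q x) with rfl | hne
  · exact le_rfl
  · exact (logLoss_Dstar_lt hx ht hne).le

/-- **Uniqueness in Proposition 1.** If a measurable discriminator `D : X → [0,1]`
satisfies `V(D) = V(D*) > -∞`, then `D = D*` `μ`-almost everywhere on `{p + q > 0}`. -/
theorem optimal_discriminator_unique {X : Type*} [MeasurableSpace X] (μ : Measure X)
    (p q : X → ℝ≥0) (hp : Measurable p) (hq : Measurable q)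
    (hp1 : ∫⁻ x, (p x : ℝ≥0∞) ∂μ = 1) (hq1 : ∫⁻ x, (q x : ℝ≥0∞) ∂μ = 1)
    (D : X → ℝ) (hD : Measurable D) (hD01 : ∀ x, D x ∈ Set.Icc (0 : ℝ) 1)
    (hval : V μ p q D = V μ p q (Dstar p q)) (hbot : V μ p q D ≠ ⊥) :
    ∀ᵐ x ∂μ, p x + q x ≠ 0 → D x = Dstar p q x := by
  have hDs := measurable_Dstar hp hq
  rw [V_eq_neg_lintegral_logLoss μ q hp hDs (Dstar_mem_Icc p q),
    V_eq_neg_lintegral_logLoss μ q hp hD hD01, neg_inj, EReal.coe_ennreal_eq_coe_ennreal_iff] at hval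
  rw [V_eq_neg_lintegral_logLoss μ q hp hD hD01, Ne, EReal.neg_eq_bot_iff,
    EReal.coe_ennreal_eq_top_iff, hval] at hbot
  have hae := ae_eq_of_ae_le_of_lintegral_le
    (Filter.Eventually.of_forall fun x => logLoss_Dstar_le p q x (hD01 x)) hbot
    ((measurable_logLoss hp hD).add (measurable_logLoss hq (hD.const_sub 1))).aemeasurable hval.le
  filter_upwards [hae] with x hx hpq
  by_contra hne
  exact (logLoss_Dstar_lt hpq (hD01 x) hne).ne hx
end

section
/- (Jensen–Shannon representation.) Let (X, μ) be a measure space and let p, q : X → ℝ≥0 be measurable probability density functions with respect to μ. Then ∫ p(x)·log( p(x)/(p(x)+q(x)) ) dμ(x) + ∫ q(x)·log( q(x)/(p(x)+q(x)) ) dμ(x) = −log 4 + 2·JSD(p ‖ q), where JSD(p ‖ q) = (1/2)·KL( p ‖ (p+q)/2 ) + (1/2)·KL( q ‖ (p+q)/2 ) is the Jensen–Shannon divergence and KL(f ‖ g) = ∫ f·log(f/g) dμ is the Kullback–Leibler divergence. -/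
open MeasureTheory
open scoped NNReal ENNReal

/-- The Jensen--Shannon divergence
`JSD(p ‖ q) = (1/2)·KL(p ‖ (p+q)/2) + (1/2)·KL(q ‖ (p+q)/2)`. -/
noncomputable def jsd {X : Type*} [MeasurableSpace X] (μ : Measure X)
    (p q : X → ℝ≥0) : EReal :=
  ((1 / 2 : ℝ) : EReal) * klDiv μ p (fun x => (p x + q x) / 2)
    + ((1 / 2 : ℝ) : EReal) * klDiv μ q (fun x => (p x + q x) / 2)

theorem eIntegral_coe_of_integrable {X : Type*} [MeasurableSpace X] {μ : Measure X}
    {f : X → ℝ} (hf : Integrable f μ) :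
    eIntegral μ (fun x => (f x : EReal)) = ((∫ x, f x ∂μ : ℝ) : EReal) := by
  have h_coe (r : ℝ) : erealToENNReal (r : EReal) = ENNReal.ofReal r := by
    simp [erealToENNReal]
  have h_pos : ∫⁻ x, ENNReal.ofReal (f x) ∂μ ≠ ∞ := hf.lintegral_lt_top.ne
  have h_neg : ∫⁻ x, ENNReal.ofReal (-f x) ∂μ ≠ ∞ := hf.neg.lintegral_lt_top.ne
  rw [integral_eq_lintegral_pos_part_sub_lintegral_neg_part hf, EReal.coe_sub,
    EReal.coe_ennreal_toReal h_pos, EReal.coe_ennreal_toReal h_neg]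
  simp only [eIntegral, ← EReal.coe_neg, h_coe]

theorem coe_mul_log_div {a b : ℝ≥0} (h : b = 0 → a = 0) :
    ((a : ℝ≥0∞) : EReal) * ENNReal.log ((a : ℝ≥0∞) / (b : ℝ≥0∞))
      = (((a : ℝ) * Real.log ((a : ℝ) / (b : ℝ)) : ℝ) : EReal) := by
  rcases eq_or_ne a 0 with rfl | ha
  · simp
  · have hb : b ≠ 0 := fun hb => ha (h hb)
    rw [← ENNReal.coe_div hb, ENNReal.log_pos_real (by simp [ha, hb]) ENNReal.coe_ne_top,
      EReal.coe_mul, EReal.coe_nnreal_eq_coe_real]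
    simp

theorem klDiv_eq_integral {X : Type*} [MeasurableSpace X] {μ : Measure X} {f g : X → ℝ≥0}
    (hfg : ∀ x, g x = 0 → f x = 0)
    (hint : Integrable (fun x => (f x : ℝ) * Real.log ((f x : ℝ) / (g x : ℝ))) μ) :
    klDiv μ f g = ((∫ x, (f x : ℝ) * Real.log ((f x : ℝ) / (g x : ℝ)) ∂μ : ℝ) : EReal) := by
  rw [← eIntegral_coe_of_integrable hint, klDiv]
  simp only [coe_mul_log_div (hfg _)]

theorem abs_mul_log_div_add_le {a b : ℝ} (ha : 0 ≤ a) (hb : 0 ≤ b) :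
    |a * Real.log (a / (a + b))| ≤ b := by
  rcases ha.eq_or_lt with rfl | ha
  · simpa using hb
  · have h_inv : Real.log (a / (a + b)) = -Real.log ((a + b) / a) := by
      rw [← Real.log_inv, inv_div]
    have h_nonneg : 0 ≤ Real.log ((a + b) / a) :=
      Real.log_nonneg ((one_le_div ha).2 (by linarith))
    have h_le : Real.log ((a + b) / a) ≤ (a + b) / a - 1 :=
      Real.log_le_sub_one_of_pos (by positivity)
    rw [h_inv, mul_neg, abs_neg, abs_of_nonneg (by positivity)]
    calc a * Real.log ((a + b) / a) ≤ a * ((a + b) / a - 1) := by gcongr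
      _ = b := by field_simp; ring

theorem mul_log_div_half {a c : ℝ} (h : c = 0 → a = 0) :
    a * Real.log (a / (c / 2)) = a * Real.log (a / c) + a * Real.log 2 := by
  rcases eq_or_ne a 0 with rfl | ha
  · simp
  · have hc : c ≠ 0 := fun hc => ha (h hc)
    rw [← mul_add, ← Real.log_mul (div_ne_zero ha hc) two_ne_zero]
    congr 2
    field_simp

theorem integrable_coe_of_lintegral_eq_one {X : Type*} [MeasurableSpace X] {μ : Measure X}
    {p : X → ℝ≥0} (hp : Measurable p) (hp1 : ∫⁻ x, (p x : ℝ≥0∞) ∂μ = 1) :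
    Integrable (fun x => (p x : ℝ)) μ :=
  ⟨hp.coe_nnreal_real.aestronglyMeasurable, by simp [HasFiniteIntegral, hp1]⟩

/-- Halving the reference density `p + q` shifts the divergence from `p` by `log 2`;
both divergences are finite. -/
theorem exists_klDiv_add_eq {X : Type*} [MeasurableSpace X] {μ : Measure X}
    {p q : X → ℝ≥0} (hp : Measurable p) (hq : Measurable q)
    (hp1 : ∫⁻ x, (p x : ℝ≥0∞) ∂μ = 1) (hq1 : ∫⁻ x, (q x : ℝ≥0∞) ∂μ = 1) :
    ∃ r : ℝ, klDiv μ p (fun x => p x + q x) = (r : EReal) ∧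
      klDiv μ p (fun x => (p x + q x) / 2) = ((r + Real.log 2 : ℝ) : EReal) := by
  have hip := integrable_coe_of_lintegral_eq_one hp hp1
  have hiq := integrable_coe_of_lintegral_eq_one hq hq1
  have h_one : ∫ x, (p x : ℝ) ∂μ = 1 := by
    rw [integral_eq_lintegral_of_nonneg_ae (.of_forall fun x => (p x).coe_nonneg)
      hip.aestronglyMeasurable]
    simp [hp1]
  have h_zero (x : X) (h : p x + q x = 0) : p x = 0 := (add_eq_zero.1 h).1
  have h_int : Integrable
      (fun x => (p x : ℝ) * Real.log ((p x : ℝ) / ((p x + q x : ℝ≥0) : ℝ))) μ := by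
    refine hiq.mono' (Measurable.aestronglyMeasurable (by fun_prop)) (.of_forall fun x => ?_)
    rw [NNReal.coe_add]
    exact abs_mul_log_div_add_le (p x).coe_nonneg (q x).coe_nonneg
  have h_half : (fun x => (p x : ℝ) * Real.log ((p x : ℝ) / (((p x + q x) / 2 : ℝ≥0) : ℝ)))
      = fun x => (p x : ℝ) * Real.log ((p x : ℝ) / ((p x + q x : ℝ≥0) : ℝ))
        + (p x : ℝ) * Real.log 2 := by
    ext x
    rw [NNReal.coe_div, NNReal.coe_two]
    exact mul_log_div_half fun h => by exact_mod_cast h_zero x (by exact_mod_cast h)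
  refine ⟨_, klDiv_eq_integral h_zero h_int, ?_⟩
  rw [klDiv_eq_integral (fun x h => h_zero x (by simpa using h))
    (h_half ▸ h_int.add (hip.mul_const _)), h_half,
    integral_add h_int (hip.mul_const _), integral_mul_const, h_one, one_mul]

/-- **Jensen–Shannon representation.** `C(p,q) = -log 4 + 2·JSD(p ‖ q)`. -/
theorem criterion_eq_jsd {X : Type*} [MeasurableSpace X] (μ : Measure X)
    (p q : X → ℝ≥0) (hp : Measurable p) (hq : Measurable q)
    (hp1 : ∫⁻ x, (p x : ℝ≥0∞) ∂μ = 1) (hq1 : ∫⁻ x, (q x : ℝ≥0∞) ∂μ = 1) :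
    Cval μ p q = ((-Real.log 4 : ℝ) : EReal) + (2 : EReal) * jsd μ p q := by
  obtain ⟨a, ha, ha2⟩ := exists_klDiv_add_eq hp hq hp1 hq1
  obtain ⟨b, hb, hb2⟩ := exists_klDiv_add_eq hq hp hq1 hp1
  simp only [add_comm (q _)] at hb hb2
  have hC : Cval μ p q
      = klDiv μ p (fun x => p x + q x) + klDiv μ q (fun x => p x + q x) := by
    simp only [Cval, klDiv, ENNReal.coe_add]
  have h_log : Real.log 4 = 2 * Real.log 2 := by
    rw [show (4 : ℝ) = 2 ^ 2 by norm_num, Real.log_pow, Nat.cast_ofNat]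
  rw [hC, jsd, ha, ha2, hb, hb2, show (2 : EReal) = ((2 : ℝ) : EReal) from rfl]
  norm_cast
  rw [h_log]
  ring
end
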